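/- arXiv:1810.03995 — 3 statements merged into one kernel-verified Lean document; each statement's English description precedes it below -/
import Mathlib

section
/- Let X be a real Banach space, A ⊆ X a nonempty, convex, norm-closed set, and F : X → X* a Brezis pseudomonotone operator. Then the solution set of the variational inequality VI(F, A), namely S = { x̄ ∈ A : ⟨F(x̄), y − x̄⟩ ≥ 0 for all y ∈ A }, is weakly sequentially closed: if x_k ∈ S for all k and x_k ⇀ x̄ weakly in X, then x̄ ∈ S. -/
open Filter Topology

/-- An operator `F : X → X*` is *Brezis pseudomonotone* if whenever `x_k ⇀ x₀` weakly and
`limsup_k ⟨F(x_k), x_k - x₀⟩ ≤ 0`, then for every `y`,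
`⟨F(x₀), x₀ - y⟩ ≤ liminf_k ⟨F(x_k), x_k - y⟩`. -/
def BrezisPseudomonotone {X : Type*} [NormedAddCommGroup X] [NormedSpace ℝ X]
    (F : X → (X →L[ℝ] ℝ)) : Prop :=
  ∀ (x : ℕ → X) (x₀ : X),
    (∀ f : X →L[ℝ] ℝ, Tendsto (fun k => f (x k)) atTop (𝓝 (f x₀))) →
    limsup (fun k => ((F (x k) (x k - x₀) : ℝ) : EReal)) atTop ≤ 0 →
    ∀ y : X, ((F x₀ (x₀ - y) : ℝ) : EReal) ≤
      liminf (fun k => ((F (x k) (x k - y) : ℝ) : EReal)) atTop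

/-- A norm-closed convex set is weakly sequentially closed. -/
theorem Convex.mem_of_isClosed_of_tendsto_dual {X : Type*} [NormedAddCommGroup X]
    [NormedSpace ℝ X] {A : Set X} (hconv : Convex ℝ A) (hclosed : IsClosed A)
    {x : ℕ → X} (hxA : ∀ k, x k ∈ A) {x₀ : X}
    (hweak : ∀ f : X →L[ℝ] ℝ, Tendsto (fun k => f (x k)) atTop (𝓝 (f x₀))) :
    x₀ ∈ A := by
  by_contra h
  obtain ⟨f, u, hfu, hu⟩ := geometric_hahn_banach_point_closed hconv hclosed h
  exact hfu.not_ge (ge_of_tendsto' (hweak f) fun k => (hu _ (hxA k)).le)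

/-- For a Brezis pseudomonotone operator `F` and a nonempty, convex, norm-closed set `A`,
the solution set of the variational inequality `VI(F, A)` is weakly sequentially closed. -/
theorem brezisPseudomonotone_solutionSet_weaklySeqClosed
    {X : Type*} [NormedAddCommGroup X] [NormedSpace ℝ X] [CompleteSpace X]
    (A : Set X) (hA : A.Nonempty) (hconv : Convex ℝ A) (hclosed : IsClosed A)
    (F : X → (X →L[ℝ] ℝ)) (hF : BrezisPseudomonotone F)
    (x : ℕ → X)
    (hxA : ∀ k, x k ∈ A)
    (hxsol : ∀ k, ∀ y ∈ A, 0 ≤ F (x k) (y - x k))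
    (x₀ : X)
    (hweak : ∀ f : X →L[ℝ] ℝ, Tendsto (fun k => f (x k)) atTop (𝓝 (f x₀))) :
    x₀ ∈ A ∧ ∀ y ∈ A, 0 ≤ F x₀ (y - x₀) := by
  have hx₀ : x₀ ∈ A := hconv.mem_of_isClosed_of_tendsto_dual hclosed hxA hweak
  have hle (y : X) (hy : y ∈ A) (k : ℕ) : ((F (x k) (x k - y) : ℝ) : EReal) ≤ 0 := by
    have h := hxsol k y hy
    rw [← neg_sub, map_neg] at h
    exact_mod_cast neg_nonneg.mp h
  refine ⟨hx₀, fun y hy => ?_⟩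
  have hlimsup : limsup (fun k => ((F (x k) (x k - x₀) : ℝ) : EReal)) atTop ≤ 0 :=
    limsup_le_of_le (h := Eventually.of_forall (hle x₀ hx₀))
  have hliminf : liminf (fun k => ((F (x k) (x k - y) : ℝ) : EReal)) atTop ≤ 0 :=
    liminf_le_of_le (h := fun _ hb => (hb.exists.elim fun k hk => hk.trans (hle y hy k)))
  have h : F x₀ (x₀ - y) ≤ 0 := by exact_mod_cast (hF x x₀ hweak hlimsup y).trans hliminf
  rw [← neg_sub, map_neg]
  exact neg_nonneg.mpr h
end

section
/- Let X = ℝⁿ be a finite-dimensional real Hilbert space with the Euclidean inner product, and F : ℝⁿ → ℝⁿ a map. Then F is bounded (maps bounded sets to bounded sets) and Brezis pseudomonotone if and only if F is continuous. -/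
open Filter Topology Bornology
open scoped RealInnerProductSpace

/-- A map sending bounded sets to bounded sets and satisfying Brezis' pseudomonotonicity inequality
along norm convergent sequences is continuous when the ambient space is proper. -/
theorem continuous_of_bounded_of_brezisPseudomonotone
    {E : Type*} [NormedAddCommGroup E] [InnerProductSpace ℝ E] [ProperSpace E] {F : E → E}
    (hb : ∀ s : Set E, IsBounded s → IsBounded (F '' s))
    (hp : ∀ (x : ℕ → E) (x₀ : E), Tendsto x atTop (𝓝 x₀) →
      limsup (fun k => ((⟪F (x k), x k - x₀⟫ : ℝ) : EReal)) atTop ≤ 0 →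
      ∀ y : E, ((⟪F x₀, x₀ - y⟫ : ℝ) : EReal) ≤
        liminf (fun k => ((⟪F (x k), x k - y⟫ : ℝ) : EReal)) atTop) :
    Continuous F := by
  rw [continuous_iff_seqContinuous]
  intro x x₀ hx
  refine tendsto_of_subseq_tendsto fun ns hns => ?_
  have hxn : Tendsto (fun k => x (ns k)) atTop (𝓝 x₀) := hx.comp hns
  obtain ⟨f, -, φ, hφ, hf⟩ := tendsto_subseq_of_bounded
    (hb _ (Metric.isBounded_range_of_tendsto _ hxn))
    (fun k => Set.mem_image_of_mem F (Set.mem_range_self k))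
  refine ⟨φ, ?_⟩
  have hu : Tendsto (fun k => x (ns (φ k))) atTop (𝓝 x₀) := hxn.comp hφ.tendsto_atTop
  have hlim (y : E) : Tendsto (fun k => ((⟪F (x (ns (φ k))), x (ns (φ k)) - y⟫ : ℝ) : EReal))
      atTop (𝓝 ((⟪f, x₀ - y⟫ : ℝ) : EReal)) :=
    (continuous_coe_real_ereal.tendsto _).comp (hf.inner (hu.sub_const y))
  have key : ⟪F x₀, x₀ - (x₀ - (F x₀ - f))⟫ ≤ ⟪f, x₀ - (x₀ - (F x₀ - f))⟫ := by
    have h := hp _ x₀ hu (by simp [(hlim x₀).limsup_eq]) (x₀ - (F x₀ - f))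
    rw [(hlim _).liminf_eq] at h
    exact_mod_cast h
  rw [sub_sub_cancel, ← sub_nonpos, ← inner_sub_left] at key
  rw [sub_eq_zero.mp (real_inner_self_nonpos.mp key)]
  exact hf

/-- A continuous map on a proper space sends bounded sets to bounded sets. -/
theorem isBounded_image_of_continuous {E E' : Type*} [PseudoMetricSpace E] [ProperSpace E]
    [PseudoMetricSpace E'] {F : E → E'} (hF : Continuous F) {s : Set E} (hs : IsBounded s) :
    IsBounded (F '' s) :=
  (hs.isCompact_closure.image hF).isBounded.subset (Set.image_mono subset_closure)

/-- In `ℝⁿ` (where weak and norm convergence of sequences coincide), a map `F : ℝⁿ → ℝⁿ`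
is bounded (maps bounded sets to bounded sets) and Brezis pseudomonotone (with respect to
the Euclidean inner-product pairing) if and only if it is continuous. -/
theorem bounded_brezisPseudomonotone_iff_continuous
    (n : ℕ) (F : EuclideanSpace ℝ (Fin n) → EuclideanSpace ℝ (Fin n)) :
    ((∀ s : Set (EuclideanSpace ℝ (Fin n)), IsBounded s → IsBounded (F '' s)) ∧
      ∀ (x : ℕ → EuclideanSpace ℝ (Fin n)) (x₀ : EuclideanSpace ℝ (Fin n)),
        Tendsto x atTop (𝓝 x₀) →
        limsup (fun k => ((⟪F (x k), x k - x₀⟫ : ℝ) : EReal)) atTop ≤ 0 →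
        ∀ y : EuclideanSpace ℝ (Fin n),
          ((⟪F x₀, x₀ - y⟫ : ℝ) : EReal) ≤
            liminf (fun k => ((⟪F (x k), x k - y⟫ : ℝ) : EReal)) atTop) ↔
    Continuous F := by
  refine ⟨fun h => continuous_of_bounded_of_brezisPseudomonotone h.1 h.2, fun hF =>
    ⟨fun s hs => isBounded_image_of_continuous hF hs, fun x x₀ hx _ y => ?_⟩⟩
  have hlim : Tendsto (fun k => ((⟪F (x k), x k - y⟫ : ℝ) : EReal)) atTop
      (𝓝 ((⟪F x₀, x₀ - y⟫ : ℝ) : EReal)) :=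
    (continuous_coe_real_ereal.tendsto _).comp
      (((hF.tendsto x₀).comp hx).inner (hx.sub_const y))
  exact hlim.liminf_eq.ge
end

section
/- Let X be a real Banach space, A ⊆ X a nonempty, convex, weakly compact set, and F : X → X* a bounded, Brezis pseudomonotone operator. Then the variational inequality VI(F, A) admits a solution, i.e. there exists x̂ ∈ A such that ⟨F(x̂), y − x̂⟩ ≥ 0 for all y ∈ A. -/
open Filter Topology Bornology

/-- A finite set `S` is dominant for a family of rankings `r` if no point strictly beats, in every
ranking, the lowest element of `S`. -/
def Dominant {V I α : Type*} [LinearOrder α] (r : I → V → α) (S : Finset V) : Prop :=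
  ∀ y, ∃ i, ∀ x ∈ S, r i y ≤ r i x

section Scarf

variable {V I α : Type*} [DecidableEq V] [Fintype I] [DecidableEq I] [LinearOrder α]

open Finset Classical in
/-- A dominant set with one element fewer than there are rankings extends to a dominant set by
one element in exactly two ways, provided it is not extremal in the sense of `hM`. -/
theorem card_dominant_insert_eq_two [Fintype V] {r : I → V → α} (hr : ∀ i, Function.Injective (r i))
    {Q : Finset V} (hQ : Dominant r Q) (hQne : Q.Nonempty) (hcard : #Q + 1 = Fintype.card I)
    (hM : ∀ j, ∃ v, ∀ k, k ≠ j → ∃ x ∈ Q, r k x < r k v) :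
    #{v | v ∉ Q ∧ Dominant r (insert v Q)} = 2 := by
  have hmin : ∀ i, ∃ x ∈ Q, ∀ y ∈ Q, r i x ≤ r i y := fun i => exists_min_image Q (r i) hQne
  choose m hmQ hm using hmin
  have hsub : ∀ s : Finset I, (∀ x ∈ Q, ∃ i ∈ s, m i = x) → #Q ≤ #s := fun s hs =>
    (card_le_card fun x hx => by simpa using hs x hx).trans (card_image_le (f := m))
  have hinj : ∀ j, (∀ x ∈ Q, ∃ i, i ≠ j ∧ m i = x) → Set.InjOn m {i | i ≠ j} := by
    intro j hj
    have h1 : Q ⊆ (univ.erase j).image m := fun x hx => by simpa using hj x hx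
    have h2 := card_le_card h1
    have h3 : #(univ.erase j) = #Q := by
      rw [card_erase_of_mem (mem_univ j), card_univ]; omega
    have h4 : #((univ.erase j).image m) = #(univ.erase j) :=
      le_antisymm card_image_le (by omega)
    have := card_image_iff.1 h4
    convert this using 1
    ext; simp
  have hsurj : ∀ x ∈ Q, ∃ i, m i = x := by
    intro x hx
    obtain ⟨i, hi⟩ := hQ x
    exact ⟨i, hr i (le_antisymm (hm i x hx) (hi _ (hmQ i)))⟩
  obtain ⟨a, -, b, -, hab, hmab⟩ : ∃ a ∈ (univ : Finset I), ∃ b ∈ (univ : Finset I),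
      a ≠ b ∧ m a = m b :=
    exists_ne_map_eq_of_card_lt_of_maps_to (t := Q) (by rw [card_univ]; omega)
      (fun i _ => hmQ i)
  -- the best point among those beating every minimum except possibly the `j`-th
  have hmax : ∀ j, ∃ v, (∀ k, k ≠ j → r k (m k) < r k v) ∧
      ∀ w, (∀ k, k ≠ j → r k (m k) < r k w) → r j w ≤ r j v := by
    intro j
    obtain ⟨v, hv⟩ := hM j
    obtain ⟨w, hw, hw'⟩ := exists_max_image
      ({w | ∀ k, k ≠ j → r k (m k) < r k w} : Finset V) (r j) ⟨v, by
        simp only [mem_filter, mem_univ, true_and]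
        intro k hk
        obtain ⟨x, hx, hxv⟩ := hv k hk
        exact (hm k x hx).trans_lt hxv⟩
    exact ⟨w, by simpa using hw, fun u hu => hw' u (by simpa using hu)⟩
  choose φ hφ hφmax using hmax
  have hle : ∀ j v, (∀ k, k ≠ j → r k (m k) < r k v) → r j v ≤ r j (m j) := by
    intro j v hv
    obtain ⟨i, hi⟩ := hQ v
    by_cases hij : i = j
    · exact hij ▸ hi _ (hmQ i)
    · exact absurd (hi _ (hmQ i)) (not_le.2 (hv i hij))
  have hdom : ∀ j, Dominant r (insert (φ j) Q) := by
    intro j y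
    by_cases hy : ∀ k, k ≠ j → r k (m k) < r k y
    · refine ⟨j, fun x hx => ?_⟩
      rcases mem_insert.1 hx with rfl | hx
      · exact hφmax j y hy
      · exact (hle j y hy).trans (hm j x hx)
    · push Not at hy
      obtain ⟨k, hkj, hk⟩ := hy
      refine ⟨k, fun x hx => ?_⟩
      rcases mem_insert.1 hx with rfl | hx
      · exact hk.trans (hφ j k hkj).le
      · exact hk.trans (hm k x hx)
  have hnotin : ∀ j j', j ≠ j' → m j = m j' → φ j ∉ Q := by
    intro j j' hjj hmj hmem
    obtain ⟨i, hi⟩ := hsurj _ hmem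
    by_cases hij : i = j
    · have := hφ j j' hjj.symm
      rw [← hmj, ← hi, hij] at this
      exact this.false
    · have := hφ j i hij
      rw [hi] at this
      exact this.false
  have hne : φ a ≠ φ b := by
    intro h
    obtain ⟨i, hi⟩ := hQ (φ a)
    by_cases hia : i = a
    · exact absurd (hi _ (hmQ i)) (not_le.2 (h ▸ hφ b i (hia ▸ hab)))
    · exact absurd (hi _ (hmQ i)) (not_le.2 (hφ a i hia))
  rw [card_eq_two]
  refine ⟨φ a, φ b, hne, ?_⟩
  ext v
  simp only [mem_filter, mem_univ, true_and, mem_insert, mem_singleton]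
  refine ⟨?_, ?_⟩
  · rintro ⟨hvQ, hv⟩
    obtain ⟨j, hj⟩ := hv v
    have hj' : ∀ x ∈ Q, r j v < r j x := fun x hx =>
      lt_of_le_of_ne (hj x (mem_insert_of_mem hx)) fun h => hvQ (hr j h ▸ hx)
    have hattain : ∀ x ∈ Q, ∃ i, m i = x ∧ r i x < r i v := by
      intro x hx
      obtain ⟨i, hi⟩ := hv x
      refine ⟨i, hr i (le_antisymm (hm i x hx) (hi _ (mem_insert_of_mem (hmQ i)))), ?_⟩
      exact lt_of_le_of_ne (hi v (mem_insert_self _ _)) fun h => hvQ (hr i h ▸ hx)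
    have hvM : ∀ k, k ≠ j → r k (m k) < r k v := by
      intro k hkj
      by_contra hlt
      rw [not_lt] at hlt
      have h1 := hsub ((univ.erase j).erase k) fun x hx => by
        obtain ⟨i, hi, hiv⟩ := hattain x hx
        refine ⟨i, ?_, hi⟩
        simp only [mem_erase, mem_univ, and_true]
        refine ⟨?_, ?_⟩
        · rintro rfl; rw [hi] at hlt; exact absurd hiv (not_lt.2 hlt)
        · rintro rfl; exact absurd hiv (not_lt.2 (hj' x hx).le)
      rw [card_erase_of_mem (by simp [hkj]), card_erase_of_mem (mem_univ j), card_univ] at h1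
      have := hQne.card_pos
      omega
    have hjinj := hinj j fun x hx => by
      obtain ⟨i, hi, hiv⟩ := hattain x hx
      refine ⟨i, ?_, hi⟩
      rintro rfl; exact absurd hiv (not_lt.2 (hj' x hx).le)
    have hvj : v = φ j := by
      refine hr j (le_antisymm (hφmax j v hvM) ?_)
      obtain ⟨i, hi⟩ := hv (φ j)
      by_cases hij : i = j
      · exact hij ▸ hi v (mem_insert_self _ _)
      · exact absurd (hi _ (mem_insert_of_mem (hmQ i))) (not_le.2 (hφ j i hij))
    by_cases hja : j = a
    · exact Or.inl (hja ▸ hvj)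
    by_cases hjb : j = b
    · exact Or.inr (hjb ▸ hvj)
    exact absurd (hjinj (Ne.symm hja) (Ne.symm hjb) hmab) hab
  · rintro (rfl | rfl)
    · exact ⟨hnotin a b hab hmab, hdom a⟩
    · exact ⟨hnotin b a hab.symm hmab.symm, hdom b⟩

open Finset in
/-- In a set with as many elements as there are labels that misses some label, the number of
elements whose removal leaves exactly the labels other than `i₀` is even. -/
theorem even_card_erase_image_eq (l : V → I) (i₀ : I) {S : Finset V}
    (hcard : #S = Fintype.card I) (hS : S.image l ≠ univ) :
    Even #{v ∈ S | (S.erase v).image l = univ.erase i₀} := by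
  rcases ({v ∈ S | (S.erase v).image l = univ.erase i₀} : Finset V).eq_empty_or_nonempty
    with h | ⟨v, hv⟩
  · simp [h]
  obtain ⟨hvS, hv⟩ := mem_filter.1 hv
  have hlv : l v ≠ i₀ := by
    intro h
    apply hS
    rw [← insert_erase hvS, image_insert, hv, h, insert_erase (mem_univ _)]
  have hcI : #((univ : Finset I).erase i₀) = Fintype.card I - 1 := by
    rw [card_erase_of_mem (mem_univ _), card_univ]
  have hinj : Set.InjOn l (S.erase v) := by
    apply card_image_iff.1
    rw [hv, hcI, card_erase_of_mem hvS, hcard]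
  obtain ⟨w, hw, hwv⟩ : ∃ w ∈ S.erase v, l w = l v := by
    apply mem_image.1
    rw [hv]; simp [hlv]
  have hwS := mem_of_mem_erase hw
  have hwne := ne_of_mem_erase hw
  suffices h : ({v ∈ S | (S.erase v).image l = univ.erase i₀} : Finset V) = {v, w} by
    rw [h, card_pair hwne.symm]; exact even_two
  ext u
  simp only [mem_filter, mem_insert, mem_singleton]
  refine ⟨?_, ?_⟩
  · rintro ⟨huS, hu⟩
    by_contra! hne
    have hinj' : Set.InjOn l (S.erase u) := by
      apply card_image_iff.1
      rw [hu, hcI, card_erase_of_mem huS, hcard]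
    exact hwne (hinj' (by simp [hwS, hne.2.symm]) (by simp [hvS, hne.1.symm]) hwv)
  · rintro (rfl | rfl)
    · exact ⟨hvS, hv⟩
    · refine ⟨hwS, ?_⟩
      rw [← hv]
      ext i
      simp only [mem_image, mem_erase]
      constructor
      · rintro ⟨x, ⟨h1, h2⟩, rfl⟩
        by_cases hx : x = v
        · exact ⟨u, ⟨hwne, hwS⟩, by rw [hx, hwv]⟩
        · exact ⟨x, ⟨hx, h2⟩, rfl⟩
      · rintro ⟨x, ⟨h1, h2⟩, rfl⟩
        by_cases hx : x = u
        · exact ⟨v, ⟨hwne.symm, hvS⟩, by rw [hx, hwv]⟩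
        · exact ⟨x, ⟨hx, h2⟩, rfl⟩

open Finset Classical in
/-- The combinatorial lemma of Scarf: there is a dominant set carrying every label exactly once. -/
theorem exists_dominant_image_eq_univ [Fintype V] [Nonempty I] {r : I → V → α}
    (hr : ∀ i, Function.Injective (r i))
    {s : I → V} (hs : ∀ i v, r i (s i) ≤ r i v)
    (hs' : ∀ i k v, k ≠ i → v ∉ Set.range s → r k v < r k (s i))
    (hne : ∃ v, v ∉ Set.range s) {l : V → I} (hl : ∀ i, l (s i) = i) :
    ∃ S : Finset V, Dominant r S ∧ S.image l = univ := by
  obtain ⟨i₀⟩ := ‹Nonempty I›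
  by_contra! hno
  let R : Finset (Finset V) := {S | Dominant r S ∧ #S = Fintype.card I}
  let D : Finset (Finset V) :=
    {Q | Dominant r Q ∧ #Q + 1 = Fintype.card I ∧ Q.image l = univ.erase i₀}
  have hcount := sum_card_bipartiteAbove_eq_sum_card_bipartiteBelow
    (s := D) (t := R) (fun Q S => Q ⊆ S)
  have heven : Even (∑ S ∈ R, #(bipartiteBelow (fun Q S => Q ⊆ S) D S)) := by
    refine even_sum _ fun S hS => ?_
    obtain ⟨hSd, hSc⟩ : Dominant r S ∧ #S = Fintype.card I := by simpa [R] using hS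
    rw [show #(bipartiteBelow (fun Q S => Q ⊆ S) D S) =
      #{v ∈ S | (S.erase v).image l = univ.erase i₀} from ?_]
    · exact even_card_erase_image_eq l i₀ hSc (hno S hSd)
    symm
    refine card_nbij (fun v => S.erase v) ?_ ?_ ?_
    · intro v hv
      obtain ⟨hvS, hv⟩ := mem_filter.1 hv
      simp only [bipartiteBelow, coe_filter, Set.mem_ofPred_eq, D, mem_filter, mem_univ, true_and]
      refine ⟨⟨fun y => ?_, ?_, hv⟩, erase_subset _ _⟩
      · obtain ⟨i, hi⟩ := hSd y
        exact ⟨i, fun x hx => hi x (mem_of_mem_erase hx)⟩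
      · rw [card_erase_add_one hvS, hSc]
    · intro v hv w hw h
      exact (erase_injOn S) (mem_filter.1 hv).1 (mem_filter.1 hw).1 h
    · intro Q hQ
      simp only [bipartiteBelow, coe_filter, Set.mem_ofPred_eq, D, mem_filter, mem_univ,
        true_and] at hQ
      obtain ⟨⟨-, hQc, hQl⟩, hQS⟩ := hQ
      obtain ⟨v, hv⟩ : ∃ v, S \ Q = {v} := by
        apply card_eq_one.1
        rw [card_sdiff_of_subset hQS]; omega
      have hQv : S.erase v = Q := by
        rw [← sdiff_singleton_eq_erase, ← hv, Finset.sdiff_sdiff_eq_self hQS]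
      refine ⟨v, ?_, hQv⟩
      have : v ∈ S \ Q := by simp [hv]
      simp [(mem_sdiff.1 this).1, hQv, hQl]
  have hdeg : ∀ Q ∈ D, #(bipartiteAbove (fun Q S => Q ⊆ S) R Q) =
      #{v | v ∉ Q ∧ Dominant r (insert v Q)} := by
    intro Q hQ
    have hQc : #Q + 1 = Fintype.card I := (mem_filter.1 hQ).2.2.1
    symm
    refine card_nbij (fun v => insert v Q) ?_ ?_ ?_
    · intro v hv
      obtain ⟨-, hvQ, hv⟩ := mem_filter.1 hv
      simp [bipartiteAbove, R, hv, card_insert_of_notMem hvQ, hQc]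
    · intro v hv w hw h
      obtain ⟨-, hvQ, hv⟩ := mem_filter.1 hv
      exact (mem_insert.1 (show v ∈ insert w Q from
        (show insert v Q = insert w Q from h) ▸ mem_insert_self v Q)).resolve_right hvQ
    · intro S hS
      simp only [bipartiteAbove, coe_filter, Set.mem_ofPred_eq, R, mem_filter, mem_univ,
        true_and] at hS
      obtain ⟨⟨hSd, hSc⟩, hQS⟩ := hS
      obtain ⟨v, hv⟩ : ∃ v, S \ Q = {v} := by
        apply card_eq_one.1
        rw [card_sdiff_of_subset hQS]; omega
      have hvm : v ∈ S \ Q := by simp [hv]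
      have hQv : insert v Q = S := by
        rw [insert_eq, ← hv, sdiff_union_of_subset hQS]
      exact ⟨v, by simp [hQv, hSd, (mem_sdiff.1 hvm).2], hQv⟩
  have hsinj : Function.Injective s := fun i j h => by rw [← hl i, h, hl]
  let Q₀ : Finset V := (univ.erase i₀).image s
  have hQ₀dom : ∀ y, y ∈ Set.range s → ∃ i, ∀ x, r i y ≤ r i x := by
    rintro _ ⟨j, rfl⟩
    exact ⟨j, hs j⟩
  have hQ₀ : Q₀ ∈ D := by
    simp only [D, mem_filter, mem_univ, true_and]
    refine ⟨fun y => ?_, ?_, ?_⟩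
    · by_cases hy : y ∈ Set.range s
      · obtain ⟨i, hi⟩ := hQ₀dom y hy
        exact ⟨i, fun x _ => hi x⟩
      · refine ⟨i₀, fun x hx => ?_⟩
        obtain ⟨k, hk, rfl⟩ := mem_image.1 hx
        exact (hs' k i₀ y (ne_of_mem_erase hk).symm hy).le
    · rw [card_image_of_injective _ hsinj, card_erase_add_one (mem_univ _), card_univ]
    · rw [image_image, show l ∘ s = id from funext hl, image_id]
  have hdeg₀ : #{v | v ∉ Q₀ ∧ Dominant r (insert v Q₀)} = 1 := by
    obtain ⟨v₁, hv₁⟩ := hne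
    obtain ⟨v₀, hv₀, hmax⟩ := exists_max_image ({v | v ∉ Set.range s} : Finset V) (r i₀)
      ⟨v₁, by simpa using hv₁⟩
    replace hv₀ : v₀ ∉ Set.range s := (mem_filter.1 hv₀).2
    replace hmax : ∀ y, y ∉ Set.range s → r i₀ y ≤ r i₀ v₀ := fun y hy =>
      hmax y (mem_filter.2 ⟨mem_univ _, hy⟩)
    rw [card_eq_one]
    refine ⟨v₀, ?_⟩
    ext v
    simp only [mem_filter, mem_univ, true_and, mem_singleton]
    constructor
    · rintro ⟨hvQ, hv⟩
      have key : ∀ y, y ∉ Set.range s → r i₀ y ≤ r i₀ v := by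
        intro y hy
        obtain ⟨i, hi⟩ := hv y
        by_cases hii : i = i₀
        · exact hii ▸ hi v (mem_insert_self _ _)
        · exfalso
          apply hy
          refine ⟨i, hr i (le_antisymm (hs i y) (hi _ (mem_insert_of_mem ?_)))⟩
          exact mem_image_of_mem _ (by simp [hii])
      have hvs : v ∉ Set.range s := by
        rintro ⟨j, rfl⟩
        by_cases hj : j = i₀
        · subst hj
          exact hv₀ ⟨j, hr j (le_antisymm (hs j v₀) (key v₀ hv₀))⟩
        · exact hvQ (mem_image_of_mem _ (by simp [hj]))
      exact hr i₀ (le_antisymm (hmax v hvs) (key v₀ hv₀))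
    · rintro rfl
      refine ⟨fun h => ?_, fun y => ?_⟩
      · obtain ⟨k, -, hk⟩ := mem_image.1 h
        exact hv₀ ⟨k, hk⟩
      · by_cases hy : y ∈ Set.range s
        · obtain ⟨i, hi⟩ := hQ₀dom y hy
          exact ⟨i, fun x _ => hi x⟩
        · refine ⟨i₀, fun x hx => ?_⟩
          rcases mem_insert.1 hx with rfl | hx
          · exact hmax y hy
          obtain ⟨k, hk, rfl⟩ := mem_image.1 hx
          exact (hs' k i₀ y (ne_of_mem_erase hk).symm hy).le
  have heven' : Even (∑ Q ∈ D.erase Q₀, #(bipartiteAbove (fun Q S => Q ⊆ S) R Q)) := by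
    refine even_sum _ fun Q hQ => ?_
    obtain ⟨hne₀, hQD⟩ := mem_erase.1 hQ
    rw [hdeg Q hQD]
    obtain ⟨hQd, hQc, hQl⟩ := (mem_filter.1 hQD).2
    obtain ⟨x, hxQ, hx⟩ : ∃ x ∈ Q, x ∉ Set.range s := by
      by_contra! hall
      apply hne₀
      refine eq_of_subset_of_card_le (fun x hx => ?_) ?_
      · obtain ⟨k, rfl⟩ := hall x hx
        have : l (s k) ∈ Q.image l := mem_image_of_mem _ hx
        rw [hQl, hl] at this
        exact mem_image_of_mem _ this
      · rw [card_image_of_injective _ hsinj, card_erase_of_mem (mem_univ _), card_univ]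
        omega
    rw [card_dominant_insert_eq_two hr hQd ⟨x, hxQ⟩ hQc fun j =>
      ⟨s j, fun k hk => ⟨x, hxQ, hs' j k x hk hx⟩⟩]
    exact even_two
  rw [← add_sum_erase _ _ hQ₀, hdeg Q₀ hQ₀, hdeg₀] at hcount
  rw [← hcount] at heven
  exact (Nat.not_even_iff_odd.2 (odd_one.add_even heven')) heven

end Scarf

section Simplex

variable {ι : Type*} [Fintype ι]

open Finset Classical in
/-- For every labelling of the points of an integer grid on the simplex there is a set `P` of grid
points and a set `C` of labels, all of which occur in `P`, such that no grid point exceeds, in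
every coordinate from `C`, the minimum of that coordinate over `P`. -/
theorem exists_grid_labels [Nonempty ι] {M : ℕ} (lab : (ι → ℕ) → ι) :
    ∃ (P : Finset (ι → ℕ)) (C : Finset ι), (∀ p ∈ P, ∑ i, p i = M) ∧
      (∀ i ∈ C, ∃ p ∈ P, lab p = i) ∧
      ∀ y : ι → ℕ, ∑ i, y i = M → ∃ i ∈ C, ∀ p ∈ P, y i ≤ p i := by
  let T := {p : ι → ℕ // p ∈ piAntidiag univ M}
  have hT : ∀ p : T, ∑ i, p.1 i = M := fun p => (mem_piAntidiag.1 p.2).1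
  have : Fintype T := inferInstanceAs (Fintype (piAntidiag univ M : Finset (ι → ℕ)))
  let e := Fintype.equivFin (T ⊕ ι)
  let h : ι → T ⊕ ι → ℕ :=
    fun i => Sum.elim (fun p => p.1 i + 1) (fun k => if k = i then 0 else M + 2)
  let r : ι → T ⊕ ι → ℕ ×ₗ ℕ := fun i v => toLex (h i v, (e v : ℕ))
  have hlt : ∀ i v w, h i v < h i w → r i v < r i w := fun i v w hvw =>
    Prod.Lex.toLex_lt_toLex.2 (Or.inl hvw)
  have hle : ∀ i v w, r i v ≤ r i w → h i v ≤ h i w := fun i v w hvw => by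
    rcases Prod.Lex.toLex_le_toLex.1 hvw with h' | h'
    · exact h'.le
    · exact h'.1.le
  have hpM : ∀ (p : T) i, p.1 i ≤ M := fun p i =>
    (single_le_sum (f := p.1) (fun _ _ => Nat.zero_le _) (mem_univ i)).trans (hT p).le
  have hinj : ∀ i, Function.Injective (r i) := by
    intro i v w hvw
    have : (e v : ℕ) = e w := (Prod.ext_iff.1 (toLex.injective hvw)).2
    exact e.injective (Fin.ext this)
  have hlow : ∀ i v, r i (Sum.inr i) ≤ r i v := by
    intro i v
    by_cases hv : v = Sum.inr i
    · rw [hv]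
    · refine (hlt i _ _ ?_).le
      rcases v with p | k
      · simp [h]
      · have : k ≠ i := fun hk => hv (hk ▸ rfl)
        simp [h, this]
  have hhigh : ∀ i k v, k ≠ i → v ∉ Set.range Sum.inr → r k v < r k (Sum.inr i) := by
    intro i k v hki hv
    rcases v with p | j
    · apply hlt
      have := hpM p k
      simp only [h, Sum.elim_inl, Sum.elim_inr, if_neg hki.symm]
      omega
    · exact absurd ⟨j, rfl⟩ hv
  have hne : ∃ v, v ∉ Set.range (Sum.inr : ι → T ⊕ ι) := by
    obtain ⟨i⟩ := ‹Nonempty ι›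
    exact ⟨Sum.inl ⟨Pi.single i M, by simp [mem_piAntidiag]⟩, by simp⟩
  obtain ⟨S, hSd, hSl⟩ := exists_dominant_image_eq_univ hinj hlow hhigh hne
    (l := Sum.elim (fun p => lab p.1) id) fun _ => rfl
  refine ⟨({p | Sum.inl p ∈ S} : Finset T).image Subtype.val, ({i | Sum.inr i ∉ S} : Finset ι),
    ?_, ?_, ?_⟩
  · simp only [mem_image]
    rintro _ ⟨p, -, rfl⟩
    exact hT p
  · intro i hi
    have : i ∈ S.image (Sum.elim (fun p : T => lab p.1) id) := by
      rw [hSl]; exact mem_univ i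
    obtain ⟨v, hvS, hv⟩ := mem_image.1 this
    rcases v with p | k
    · exact ⟨p.1, mem_image_of_mem _ (by simpa using hvS), hv⟩
    · obtain rfl : k = i := hv
      exact absurd hvS (mem_filter.1 hi).2
  · intro y hy
    let y' : T := ⟨y, by simp [mem_piAntidiag, hy]⟩
    obtain ⟨i, hi⟩ := hSd (Sum.inl y')
    refine ⟨i, ?_, ?_⟩
    · simp only [mem_filter, mem_univ, true_and]
      intro hiS
      simpa [h] using hle i _ _ (hi _ hiS)
    · simp only [mem_image]
      rintro _ ⟨p, hp, rfl⟩
      simpa [h, y'] using hle i _ _ (hi (Sum.inl p) (by simpa using hp))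

open Finset Classical in
/-- The points of `P` in the combinatorial lemma are close to each other, and close to the face
spanned by `C`. -/
theorem le_add_card_of_grid {M : ℕ} {P : Finset (ι → ℕ)} {C : Finset ι}
    (hP : ∀ p ∈ P, ∑ i, p i = M) (hPne : P.Nonempty)
    (hC : ∀ y : ι → ℕ, ∑ i, y i = M → ∃ i ∈ C, ∀ p ∈ P, y i ≤ p i) :
    (∀ p ∈ P, ∀ q ∈ P, ∀ k, p k ≤ q k + Fintype.card ι) ∧
      ∀ p ∈ P, ∀ k ∉ C, p k ≤ Fintype.card ι := by
  have hmin : ∀ k, ∃ p ∈ P, ∀ q ∈ P, p k ≤ q k := fun k => exists_min_image P (fun p => p k) hPne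
  choose μ hμP hμ using hmin
  have hCne : ∃ i, i ∈ C := by
    obtain ⟨p, hp⟩ := hPne
    obtain ⟨i, hi, -⟩ := hC p (hP p hp)
    exact ⟨i, hi⟩
  obtain ⟨i₁, hi₁⟩ := hCne
  have hcardC : #C ≤ Fintype.card ι := card_le_univ C
  have hsum : M < ∑ i ∈ C, μ i i + #C := by
    by_contra! hle
    obtain ⟨d, hd⟩ := Nat.exists_eq_add_of_le hle
    obtain ⟨i, hi, hy⟩ := hC
      (fun k => (if k ∈ C then μ k k + 1 else 0) + Pi.single (M := fun _ => ℕ) i₁ d k) (by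
      rw [sum_add_distrib, sum_ite_mem, univ_inter, sum_add_distrib]
      simp [hd])
    have := hy _ (hμP i)
    simp only [if_pos hi] at this
    omega
  have key : ∀ p ∈ P, ∀ k, p k + ∑ i ∈ C.erase k, μ i i ≤ M := by
    intro p hp k
    rw [← hP p hp, ← add_sum_erase _ _ (mem_univ k)]
    exact Nat.add_le_add_left ((sum_le_sum fun i _ => hμ i p hp).trans
      (sum_le_sum_of_subset (erase_subset_erase k (subset_univ C)))) _
  have hout : ∀ p ∈ P, ∀ k ∉ C, p k ≤ Fintype.card ι := by
    intro p hp k hk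
    have := key p hp k
    rw [erase_eq_of_notMem hk] at this
    omega
  refine ⟨fun p hp q hq k => ?_, hout⟩
  by_cases hk : k ∈ C
  · have h1 := key p hp k
    have h2 := hμ k q hq
    rw [← add_sum_erase _ _ hk] at hsum
    omega
  · exact (hout p hp k hk).trans (Nat.le_add_left _ _)

open Finset Classical in
/-- Every labelling of the points of the simplex admits a point whose significant coordinates all
occur as labels of nearby points. -/
theorem exists_mem_stdSimplex_near_labels [Nonempty ι] (lab : (ι → ℝ) → ι) (N : ℕ) :
    ∃ z ∈ stdSimplex ℝ ι, ∀ i, ∃ q ∈ stdSimplex ℝ ι,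
      (∀ k, |q k - z k| ≤ Fintype.card ι / (N + 1 : ℝ)) ∧
      (z i ≤ Fintype.card ι / (N + 1 : ℝ) ∨ lab q = i) := by
  have hN : (0 : ℝ) < N + 1 := by positivity
  let u : (ι → ℕ) → ι → ℝ := fun p k => p k / (N + 1 : ℝ)
  obtain ⟨P, C, hP, hlab, hC⟩ := exists_grid_labels (M := N + 1) (fun p => lab (u p))
  obtain ⟨i₁⟩ := ‹Nonempty ι›
  obtain ⟨i, hi, -⟩ := hC (Pi.single i₁ (N + 1)) (by simp)
  obtain ⟨p, hp, -⟩ := hlab i hi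
  have hne : P.Nonempty := ⟨p, hp⟩
  have : Nonempty ι := ⟨i₁⟩
  obtain ⟨hclose, hface⟩ := le_add_card_of_grid hP hne hC
  have hu : ∀ p ∈ P, u p ∈ stdSimplex ℝ ι := by
    intro p hp
    refine ⟨fun k => by positivity, ?_⟩
    rw [← sum_div, ← Nat.cast_sum, hP p hp]
    push_cast
    exact div_self hN.ne'
  refine ⟨u p, hu p hp, fun j => ?_⟩
  by_cases hj : j ∈ C
  · obtain ⟨q, hq, hqj⟩ := hlab j hj
    refine ⟨u q, hu q hq, fun k => ?_, Or.inr hqj⟩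
    have h1 : (q k : ℝ) ≤ p k + Fintype.card ι := by exact_mod_cast hclose q hq p hp k
    have h2 : (p k : ℝ) ≤ q k + Fintype.card ι := by exact_mod_cast hclose p hp q hq k
    rw [← sub_div, abs_div, abs_of_pos hN]
    gcongr
    rw [abs_le]
    constructor <;> linarith
  · refine ⟨u p, hu p hp, fun k => ?_, Or.inl ?_⟩
    · rw [sub_self, abs_zero]; positivity
    · have : (p j : ℝ) ≤ Fintype.card ι := by exact_mod_cast hface p hp j hj
      simp only [u]
      gcongr

/-- A continuous family of functions on the simplex admits a point supported on the indices where
the family is minimal. -/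
theorem exists_mem_stdSimplex_forall_pos_le [Nonempty ι] {g : (ι → ℝ) → ι → ℝ}
    (hg : ContinuousOn g (stdSimplex ℝ ι)) :
    ∃ x ∈ stdSimplex ℝ ι, ∀ i, 0 < x i → ∀ j, g x i ≤ g x j := by
  choose lab hlab using fun x => Finite.exists_min (g x)
  choose z hz q hq hqz hzi using exists_mem_stdSimplex_near_labels lab
  obtain ⟨x, hx, φ, hφ, hlim⟩ := (isCompact_stdSimplex ℝ ι).tendsto_subseq hz
  refine ⟨x, hx, fun i hi j => ?_⟩
  have hε : Tendsto (fun N : ℕ => Fintype.card ι / ((φ N : ℕ) + 1 : ℝ)) atTop (𝓝 0) := by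
    have := (tendsto_one_div_add_atTop_nhds_zero_nat (𝕜 := ℝ)).const_mul (Fintype.card ι : ℝ)
    simp only [mul_one_div, mul_zero] at this
    exact this.comp hφ.tendsto_atTop
  have hqlim : Tendsto (fun N => q (φ N) i) atTop (𝓝 x) := by
    rw [tendsto_pi_nhds] at hlim ⊢
    intro k
    have h0 : Tendsto (fun N => q (φ N) i k - z (φ N) k) atTop (𝓝 0) :=
      squeeze_zero_norm (fun N => hqz (φ N) i k) hε
    simpa using h0.add (hlim k)
  have hglim : Tendsto (fun N => g (q (φ N) i)) atTop (𝓝 (g x)) :=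
    (hg x hx).tendsto.comp (tendsto_nhdsWithin_iff.2 ⟨hqlim, Eventually.of_forall fun N => hq _ _⟩)
  rw [tendsto_pi_nhds] at hglim
  refine le_of_tendsto_of_tendsto (hglim i) (hglim j) ?_
  filter_upwards [hε.eventually_lt (tendsto_pi_nhds.1 hlim i) hi] with N hN
  have := (hzi (φ N) i).resolve_left (not_le.2 hN)
  have h2 := hlab (q (φ N) i) j
  rwa [this] at h2

end Simplex

section WeakCompactness

variable {X : Type*} [NormedAddCommGroup X] [NormedSpace ℝ X]

/-- A finite-dimensional subspace is normed, up to a factor, by finitely many functionals. -/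
theorem exists_finset_dual_norming (T : Finset X) :
    ∃ Φ : Finset (X →L[ℝ] ℝ), (∀ f ∈ Φ, ‖f‖ ≤ 1) ∧
      ∀ e ∈ Submodule.span ℝ (T : Set X), ∃ f ∈ Φ, ‖e‖ ≤ 2 * |f e| := by
  classical
  let E := Submodule.span ℝ (T : Set X)
  have : FiniteDimensional ℝ E := FiniteDimensional.span_finset ℝ T
  choose ν hν hνx using fun x : X => exists_dual_vector'' ℝ x
  have hcomp : IsCompact (Metric.sphere (0 : E) 1) := isCompact_sphere 0 1
  obtain ⟨t, hts, ht⟩ := hcomp.elim_nhds_subcover (fun x => Metric.ball x (1 / 2))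
    fun x _ => Metric.ball_mem_nhds x (by norm_num)
  refine ⟨insert 0 (t.image fun x : E => ν (x : X)), ?_, fun e he => ?_⟩
  · simp only [Finset.mem_insert, Finset.mem_image]
    rintro f (rfl | ⟨x, -, rfl⟩)
    · simp
    · exact hν x
  by_cases he0 : e = 0
  · exact ⟨0, Finset.mem_insert_self _ _, by simp [he0]⟩
  have hpos : 0 < ‖e‖ := norm_pos_iff.2 he0
  let e₁ : E := (‖e‖⁻¹ : ℝ) • ⟨e, he⟩
  have hns : ‖e₁‖ = 1 := by
    rw [norm_smul, Submodule.coe_norm, norm_inv, norm_norm]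
    exact inv_mul_cancel₀ hpos.ne'
  obtain ⟨x, hxt, hx⟩ : ∃ x ∈ t, e₁ ∈ Metric.ball x (1 / 2) := by
    simpa using ht (show e₁ ∈ Metric.sphere (0 : E) 1 by simpa using hns)
  have hdist : ‖(e₁ : X) - x‖ < 1 / 2 := by
    rwa [mem_ball_iff_norm] at hx
  refine ⟨ν x, Finset.mem_insert_of_mem (Finset.mem_image_of_mem _ hxt), ?_⟩
  have h1 : |ν x ((e₁ : X) - x)| ≤ ‖(e₁ : X) - x‖ := by
    simpa using (ν (x : X)).le_of_opNorm_le (hν x) ((e₁ : X) - x)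
  have h2 : ν (x : X) x = 1 := by
    rw [hνx]; simpa using hts x hxt
  have h3 : 1 / 2 ≤ |ν (x : X) e₁| := by
    rw [map_sub, h2] at h1
    have := neg_abs_le (ν (x : X) e₁ - 1)
    exact le_abs.2 (Or.inl (by linarith))
  have h4 : e = ‖e‖ • (e₁ : X) := by
    simp [e₁, smul_smul, hpos.ne']
  have h5 : |ν (x : X) e| = ‖e‖ * |ν (x : X) e₁| := by
    conv_lhs => rw [h4]
    simp [abs_mul]
  rw [h5]
  nlinarith

/-- In a weakly compact set, points of the weak closure are weak limits of sequences. -/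
theorem exists_seq_tendsto_of_mem_weak_closure {A B : Set X} {x₀ : X}
    (hA : IsCompact (toWeakSpace ℝ X '' A)) (hBA : B ⊆ A)
    (hx₀ : toWeakSpace ℝ X x₀ ∈ closure (toWeakSpace ℝ X '' B)) :
    ∃ x : ℕ → X, (∀ n, x n ∈ B) ∧
      ∀ f : X →L[ℝ] ℝ, Tendsto (fun n => f (x n)) atTop (𝓝 (f x₀)) := by
  classical
  have hcont : ∀ f : X →L[ℝ] ℝ, Continuous fun x : WeakSpace ℝ X => f ((toWeakSpace ℝ X).symm x) :=
    fun f => WeakBilin.eval_continuous (topDualPairing ℝ X).flip f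
  choose Φ hΦ1 hΦ using exists_finset_dual_norming (X := X)
  have hstep : ∀ (Ψ : Finset (X →L[ℝ] ℝ)) (n : ℕ), ∃ x ∈ B, ∀ f ∈ Ψ,
      |f x - f x₀| < 1 / (n + 1 : ℝ) := by
    intro Ψ n
    have hopen : {x : WeakSpace ℝ X | ∀ f ∈ Ψ, |f ((toWeakSpace ℝ X).symm x) - f x₀| <
        1 / (n + 1 : ℝ)} ∈ 𝓝 (toWeakSpace ℝ X x₀) := by
      rw [show {x : WeakSpace ℝ X | ∀ f ∈ Ψ, |f ((toWeakSpace ℝ X).symm x) - f x₀| <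
        1 / (n + 1 : ℝ)} = ⋂ f ∈ Ψ, {x : WeakSpace ℝ X | |f ((toWeakSpace ℝ X).symm x) - f x₀| <
        1 / (n + 1 : ℝ)} by ext; simp]
      refine (Filter.biInter_finset_mem Ψ).2 fun f _ => ?_
      refine (isOpen_lt ((hcont f).sub continuous_const).abs continuous_const).mem_nhds ?_
      change |f ((toWeakSpace ℝ X).symm (toWeakSpace ℝ X x₀)) - f x₀| < 1 / (n + 1 : ℝ)
      rw [LinearEquiv.symm_apply_apply, sub_self, abs_zero]
      positivity
    obtain ⟨_, hx, ⟨x, hxB, rfl⟩⟩ := mem_closure_iff_nhds.1 hx₀ _ hopen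
    exact ⟨x, hxB, by simpa using hx⟩
  choose next hnextB hnext using hstep
  -- points chosen so far, and functionals norming the spans of all their earlier stages
  let st : ℕ → Finset X × Finset (X →L[ℝ] ℝ) := fun n => Nat.rec ({x₀}, Φ {x₀})
    (fun n p => (insert (next p.2 n) p.1, p.2 ∪ Φ (insert (next p.2 n) p.1))) n
  let x : ℕ → X := fun n => next (st n).2 n
  have hst1 : ∀ n, (st (n + 1)).1 = insert (x n) (st n).1 := fun n => rfl
  have hst2 : ∀ n, (st (n + 1)).2 = (st n).2 ∪ Φ (st (n + 1)).1 := fun n => rfl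
  have hmono1 : Monotone fun n => (st n).1 := monotone_nat_of_le_succ fun n =>
    (hst1 n) ▸ Finset.subset_insert _ _
  have hmono2 : Monotone fun n => (st n).2 := monotone_nat_of_le_succ fun n =>
    (hst2 n) ▸ Finset.subset_union_left
  have hΦst : ∀ n, Φ (st n).1 ⊆ (st n).2 := by
    rintro (_ | n)
    · exact subset_rfl
    · exact (hst2 n) ▸ Finset.subset_union_right
  have hlim : ∀ k, ∀ f ∈ (st k).2, Tendsto (fun n => f (x n)) atTop (𝓝 (f x₀)) := by
    intro k f hf
    rw [tendsto_iff_norm_sub_tendsto_zero]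
    refine squeeze_zero' (Eventually.of_forall fun _ => norm_nonneg _) ?_
      (tendsto_one_div_add_atTop_nhds_zero_nat (𝕜 := ℝ))
    filter_upwards [eventually_ge_atTop k] with n hn
    exact (hnext (st n).2 n f (hmono2 hn hf)).le
  let E : Submodule ℝ X := ⨆ n, Submodule.span ℝ ((st n).1 : Set X)
  have hdir : Directed (· ≤ ·) fun n => Submodule.span ℝ ((st n).1 : Set X) :=
    Monotone.directed_le fun m n hmn => Submodule.span_mono (Finset.coe_subset.2 (hmono1 hmn))
  have hxE : ∀ n, x n ∈ E := fun n => Submodule.mem_iSup_of_mem (n + 1)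
    (Submodule.subset_span (by rw [hst1]; simp))
  have hx₀E : x₀ ∈ E := Submodule.mem_iSup_of_mem 0 (Submodule.subset_span (by simp [st]))
  refine ⟨x, fun n => hnextB _ _, fun f => ?_⟩
  suffices hw : Tendsto (fun n => toWeakSpace ℝ X (x n)) atTop (𝓝 (toWeakSpace ℝ X x₀)) from
    ((hcont f).tendsto _).comp hw
  refine hA.tendsto_nhds_of_unique_mapClusterPt
    (Eventually.of_forall fun n => Set.mem_image_of_mem _ (hBA (hnextB _ _))) ?_
  rintro _ ⟨y, -, rfl⟩ hy
  congr 1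
  have hyE : y ∈ closure (E : Set X) := by
    have h1 : toWeakSpace ℝ X y ∈ closure (toWeakSpace ℝ X '' (E : Set X)) :=
      isClosed_closure.mem_of_mapClusterPt hy
        (Eventually.of_forall fun n => subset_closure (Set.mem_image_of_mem _ (hxE n)))
    rw [← E.convex.toWeakSpace_closure ℝ] at h1
    obtain ⟨z, hz, hzy⟩ := h1
    exact (toWeakSpace ℝ X).injective hzy ▸ hz
  have hfy : ∀ k, ∀ f ∈ (st k).2, f (y - x₀) = 0 := by
    intro k f hf
    have h1 := hy.tendsto_comp ((hcont f).tendsto (toWeakSpace ℝ X y))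
    replace h1 : MapClusterPt (f y) atTop fun n => f (x n) := h1
    rw [map_sub, sub_eq_zero]
    exact eq_of_nhds_neBot (h1.clusterPt.neBot.mono (inf_le_inf_left _ (hlim k f hf)))
  by_contra hne
  have hpos : 0 < ‖y - x₀‖ := norm_pos_iff.2 (sub_ne_zero.2 hne)
  obtain ⟨z, hzE, hz⟩ := Metric.mem_closure_iff.1 hyE (‖y - x₀‖ / 4) (by positivity)
  obtain ⟨k, hk⟩ := (Submodule.mem_iSup_of_directed _ hdir).1 (E.sub_mem hzE hx₀E)
  obtain ⟨f, hf, hfz⟩ := hΦ _ _ hk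
  have h0 := hfy k f (hΦst k hf)
  have h1 : f (z - x₀) = f (z - y) := by
    rw [← sub_add_sub_cancel z y x₀, map_add, h0, add_zero]
  have h2 : |f (z - y)| ≤ ‖z - y‖ := by
    simpa using f.le_of_opNorm_le (hΦ1 _ f hf) (z - y)
  have h3 : ‖y - x₀‖ ≤ ‖z - y‖ + ‖z - x₀‖ := by
    rw [norm_sub_rev z y]; exact norm_sub_le_norm_sub_add_norm_sub y z x₀
  rw [dist_eq_norm, norm_sub_rev] at hz
  rw [h1] at hfz
  linarith

end WeakCompactness

section Pseudomonotone

variable {X : Type*} [NormedAddCommGroup X] [NormedSpace ℝ X] {F : X → (X →L[ℝ] ℝ)}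

/-- A bounded Brezis pseudomonotone operator is demicontinuous. -/
theorem BrezisPseudomonotone.continuous_apply (hF : BrezisPseudomonotone F)
    (hbdd : ∀ s : Set X, IsBounded s → IsBounded (F '' s)) (v : X) :
    Continuous fun x => F x v := by
  refine continuous_iff_seqContinuous.2 fun x x₀ hx => ?_
  obtain ⟨K, hK⟩ := (hbdd _ (Metric.isBounded_range_of_tendsto x hx)).exists_norm_le
  have hFK : ∀ k, ‖F (x k)‖ ≤ K := fun k => hK _ (Set.mem_image_of_mem _ ⟨k, rfl⟩)
  have h0 : Tendsto (fun k => F (x k) (x k - x₀)) atTop (𝓝 0) := by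
    refine squeeze_zero_norm (fun k => (F (x k)).le_of_opNorm_le (hFK k) _) ?_
    simpa using (tendsto_iff_norm_sub_tendsto_zero.1 hx).const_mul K
  have hlim := hF x x₀ (fun f => (f.continuous.tendsto _).comp hx)
    (((continuous_coe_real_ereal.tendsto 0).comp h0).limsup_eq.le)
  have hlow : ∀ w : X, ∀ c < F x₀ w, ∀ᶠ k in atTop, c < F (x k) w := by
    intro w c hc
    obtain ⟨d, hcd, hd⟩ := exists_between hc
    have h1 := hlim (x₀ - w)
    rw [sub_sub_cancel] at h1
    have h2 := eventually_lt_of_lt_liminf (lt_of_lt_of_le (EReal.coe_lt_coe_iff.2 hd) h1)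
    filter_upwards [h2, h0.eventually_lt_const (sub_pos.2 hcd)] with k hk hk0
    rw [EReal.coe_lt_coe_iff, sub_sub_eq_add_sub, add_sub_right_comm, map_add] at hk
    linarith
  refine tendsto_order.2 ⟨fun c hc => hlow v c hc, fun c hc => ?_⟩
  filter_upwards [hlow (-v) (-c) (by simpa using hc)] with k hk
  simpa using hk

/-- The variational inequality is solvable over the convex hull of finitely many points. -/
theorem exists_mem_convexHull_forall_nonneg (hF : ∀ v, Continuous fun x => F x v)
    {S : Finset X} (hS : S.Nonempty) :
    ∃ x ∈ convexHull ℝ (S : Set X), ∀ y ∈ S, 0 ≤ F x (y - x) := by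
  classical
  have : Nonempty S := hS.to_subtype
  let c : (S → ℝ) → X := fun t => ∑ i, t i • (i : X)
  have hc : Continuous c := by fun_prop
  obtain ⟨t, ht, htmin⟩ := exists_mem_stdSimplex_forall_pos_le
    (ι := S) (g := fun t i => F (c t) i)
    (Continuous.continuousOn (continuous_pi fun i : S => (hF i).comp hc))
  refine ⟨c t, ?_, fun y hy => ?_⟩
  · exact (convex_convexHull ℝ _).sum_mem (fun i _ => ht.1 i) ht.2
      fun i _ => subset_convexHull ℝ _ i.2
  · have h : F (c t) (c t) ≤ F (c t) y := by
      calc F (c t) (c t) = ∑ i, t i * F (c t) i := by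
            conv_lhs => rw [show c t = ∑ i, t i • (i : X) from rfl]
            simp [c]
        _ ≤ ∑ i, t i * F (c t) y := Finset.sum_le_sum fun i _ => by
            rcases (ht.1 i).eq_or_lt with h0 | h0
            · simp [← h0]
            · exact mul_le_mul_of_nonneg_left (htmin i h0 ⟨y, hy⟩) h0.le
        _ = F (c t) y := by rw [← Finset.sum_mul, ht.2, one_mul]
    rw [map_sub]; linarith

end Pseudomonotone

/-- If `A` is a nonempty, convex, weakly compact subset of a real Banach space `X` and
`F : X → X*` is a bounded Brezis pseudomonotone operator, then the variational inequality
`VI(F, A)` admits a solution. -/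
theorem brezisPseudomonotone_vi_existence
    {X : Type*} [NormedAddCommGroup X] [NormedSpace ℝ X] [CompleteSpace X]
    (A : Set X) (hA : A.Nonempty) (hconv : Convex ℝ A)
    (hcomp : IsCompact (toWeakSpace ℝ X '' A))
    (F : X → (X →L[ℝ] ℝ))
    (hbdd : ∀ s : Set X, IsBounded s → IsBounded (F '' s))
    (hF : BrezisPseudomonotone F) :
    ∃ x₀ ∈ A, ∀ y ∈ A, 0 ≤ F x₀ (y - x₀) := by
  classical
  let W : Finset A → Set X := fun S => {x ∈ A | ∀ y ∈ S, 0 ≤ F x (y - x)}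
  have hW : ∀ S, (W S).Nonempty := by
    intro S
    obtain ⟨a, ha⟩ := hA
    obtain ⟨x, hx, hxy⟩ := exists_mem_convexHull_forall_nonneg (hF.continuous_apply hbdd)
      (S := (insert ⟨a, ha⟩ S).image Subtype.val) (by simp)
    refine ⟨x, convexHull_min ?_ hconv hx, fun y hy => hxy y ?_⟩
    · intro y hy
      obtain ⟨z, -, rfl⟩ := Finset.mem_image.1 (Finset.mem_coe.1 hy)
      exact z.2
    · exact Finset.mem_image_of_mem _ (Finset.mem_insert_of_mem hy)
  obtain ⟨_, ⟨x₀, hx₀A, rfl⟩, hx₀⟩ := hcomp.inter_iInter_nonempty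
    (fun S => closure (toWeakSpace ℝ X '' W S)) (fun _ => isClosed_closure) fun u => by
      obtain ⟨x, hx⟩ := hW (u.biUnion id)
      refine ⟨toWeakSpace ℝ X x, Set.mem_image_of_mem _ hx.1, Set.mem_iInter₂.2 fun S hS => ?_⟩
      exact subset_closure (Set.mem_image_of_mem _
        ⟨hx.1, fun y hy => hx.2 y (Finset.mem_biUnion.2 ⟨S, hS, hy⟩)⟩)
  refine ⟨x₀, hx₀A, fun y hy => ?_⟩
  obtain ⟨x, hxW, hx⟩ := exists_seq_tendsto_of_mem_weak_closure hcomp (fun _ h => h.1)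
    (Set.mem_iInter.1 hx₀ {⟨x₀, hx₀A⟩, ⟨y, hy⟩})
  have hle : ∀ z : X, (∀ k, 0 ≤ F (x k) (z - x k)) →
      ∀ k, ((F (x k) (x k - z) : ℝ) : EReal) ≤ 0 := by
    intro z hz k
    have := hz k
    rw [← neg_sub, map_neg] at this
    exact_mod_cast neg_nonneg.1 this
  have h1 := hle x₀ fun k => (hxW k).2 ⟨x₀, hx₀A⟩ (by simp)
  have h2 := hle y fun k => (hxW k).2 ⟨y, hy⟩ (by simp)
  have h3 := (hF x x₀ hx (limsup_le_of_le (h := Eventually.of_forall h1)) y).trans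
    (liminf_le_of_le (h := fun b hb => (hb.and (Eventually.of_forall h2)).exists.elim
      fun k hk => hk.1.trans hk.2))
  rw [← neg_sub, map_neg]
  exact neg_nonneg.2 (by exact_mod_cast h3)
end
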